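/- Suppose (W,S) is a Coxeter system, A ⊆ S, and ⟨A⟩ = ⟨B⟩ × ⟨C⟩ where B ∪ C = A, ⟨C⟩ is finite, and C is the unique largest subset of A such that ⟨C⟩ is finite and splits off as a visual direct factor of ⟨A⟩. If w⟨A⟩w⁻¹ ⊆ ⟨H⟩ for some w ∈ W and H ⊆ S, then B ⊆ H. -/

import Mathlib

open Subgroup

section Reflection

open Polynomial Polynomial.Chebyshev Real

theorem Polynomial.Chebyshev.eval_S_two_mul_cos_mul_sin (θ : ℝ) (n : ℤ) :
    (S ℝ n).eval (2 * cos θ) * sin θ = sin ((n + 1) * θ) := by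
  rw [← U_real_cos, ← S_comp_two_mul_X]
  simp

/-- Two reflections at angle `π / m` generate a dihedral group of order dividing `2 * m`. -/
theorem Module.reflection_mul_reflection_pow_eq_one {V : Type*} [AddCommGroup V] [Module ℝ V]
    {x y : V} {f g : Module.Dual ℝ V} (hf : f x = 2) (hg : g y = 2) {m : ℕ} (hm : m ≠ 1)
    (hfy : f y = -2 * cos (π / m)) (hgx : g x = -2 * cos (π / m)) :
    (Module.reflection hf * Module.reflection hg) ^ m = 1 := by
  set θ : ℝ := 2 * (π / m) with hθ
  have ht : 2 * cos θ = f y * g x - 2 := by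
    rw [hfy, hgx, hθ, cos_two_mul]; ring
  ext z
  rw [Module.reflection_mul_reflection_pow_apply hf hg m z _ ht, LinearEquiv.coe_one, id]
  obtain rfl | h0 := eq_or_ne m 0
  · simp
  obtain rfl | h2 := eq_or_ne m 2
  · rw [ht]
    simp only [hfy, hgx]
    simp
    module
  have hm3 : (3 : ℝ) ≤ m := by exact_mod_cast (by omega : 3 ≤ m)
  have hmθ : m * θ = 2 * π := by rw [hθ]; field_simp
  have hsin : sin θ ≠ 0 := by
    refine (sin_pos_of_pos_of_lt_pi ?_ ?_).ne'
    · positivity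
    · nlinarith [pi_pos]
  have key (a b : ℤ) (h : a + b + 2 = m) :
      (S ℝ a).eval (2 * cos θ) + (S ℝ b).eval (2 * cos θ) = 0 := by
    have h' : (a + b + 2 : ℝ) = m := by exact_mod_cast h
    refine (mul_eq_zero.mp ?_).resolve_right hsin
    rw [add_mul, eval_S_two_mul_cos_mul_sin, eval_S_two_mul_cos_mul_sin,
      show (b + 1) * θ = 2 * π - (a + 1) * θ by rw [← hmθ, ← h']; ring, sin_two_pi_sub]
    ring
  obtain ⟨k, rfl | rfl⟩ := m.even_or_odd'
  · have h1 : (S ℝ ((((2 * k : ℕ) : ℤ) - 2) / 2)).eval (2 * cos θ) = 0 := by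
      have := key ((((2 * k : ℕ) : ℤ) - 2) / 2) ((((2 * k : ℕ) : ℤ) - 2) / 2) (by omega)
      linarith
    rw [show (((2 * k : ℕ) : ℤ) - 1) / 2 = (((2 * k : ℕ) : ℤ) - 2) / 2 by omega, h1]
    simp
  · rw [key ((((2 * k + 1 : ℕ) : ℤ) - 1) / 2) ((((2 * k + 1 : ℕ) : ℤ) - 3) / 2) (by omega),
      key (((2 * k + 1 : ℕ) : ℤ) / 2) ((((2 * k + 1 : ℕ) : ℤ) - 2) / 2) (by omega)]
    simp

end Reflection

namespace CoxeterSystem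

variable {I W : Type*} [Group W] {M : CoxeterMatrix I} (cs : CoxeterSystem M W)

/-- The standard parabolic (visual) subgroup generated by the simple reflections in `J`. -/
abbrev parabolic (J : Set I) : Subgroup W := closure (cs.simple '' J)

/-! ### The geometric representation -/

section Geometric

open Real

/-- The coroot of `i`, as a linear form on the space spanned by the simple roots. -/
noncomputable def coroot (M : CoxeterMatrix I) (i : I) : Module.Dual ℝ (I →₀ ℝ) :=
  Finsupp.linearCombination ℝ fun j ↦ -2 * cos (π / M i j)

theorem coroot_single (i j : I) :
    coroot M i (Finsupp.single j 1) = -2 * cos (π / M i j) := by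
  simp [coroot]

theorem coroot_single_self (i : I) : coroot M i (Finsupp.single i 1) = 2 := by
  simp [coroot_single]

theorem isLiftable_reflection (M : CoxeterMatrix I) :
    M.IsLiftable fun i ↦ Module.reflection (coroot_single_self (M := M) i) := by
  intro i j
  obtain rfl | hij := eq_or_ne i j
  · ext1 z
    simpa using Module.involutive_reflection (coroot_single_self (M := M) i) z
  · exact Module.reflection_mul_reflection_pow_eq_one _ _ (M.off_diagonal i j hij)
      (coroot_single i j) (by rw [coroot_single, M.symmetric])

/-- The geometric representation of a Coxeter group. -/
noncomputable def geometricRep : W →* ((I →₀ ℝ) ≃ₗ[ℝ] (I →₀ ℝ)) :=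
  cs.lift ⟨_, isLiftable_reflection M⟩

theorem geometricRep_simple (i : I) (v : I →₀ ℝ) :
    cs.geometricRep (cs.simple i) v = v - coroot M i v • Finsupp.single i 1 := by
  rw [geometricRep, lift_apply_simple, Module.reflection_apply]

theorem geometricRep_apply_of_mem_parabolic {J : Set I} {w : W} (hw : w ∈ cs.parabolic J)
    (v : I →₀ ℝ) {i : I} (hi : i ∉ J) : cs.geometricRep w v i = v i := by
  induction hw using closure_induction generalizing v with
  | mem x hx =>
    obtain ⟨j, hj, rfl⟩ := hx
    have : j ≠ i := fun h ↦ hi (h ▸ hj)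
    simp [geometricRep_simple, this]
  | one => simp
  | mul x y _ _ hx hy => rw [map_mul, LinearEquiv.mul_apply, hx, hy]
  | inv x _ hx =>
    rw [← hx, ← LinearEquiv.mul_apply, ← map_mul, mul_inv_cancel, map_one, LinearEquiv.coe_one, id]

theorem simple_mem_parabolic_iff {J : Set I} {i : I} :
    cs.simple i ∈ cs.parabolic J ↔ i ∈ J := by
  refine ⟨fun h ↦ by_contra fun hi ↦ ?_, fun h ↦ subset_closure (Set.mem_image_of_mem _ h)⟩
  have := cs.geometricRep_apply_of_mem_parabolic h (Finsupp.single i 1) hi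
  rw [geometricRep_simple, coroot_single_self] at this
  norm_num at this

end Geometric

/-! ### The inversion cocycle -/

section Cocycle

open scoped Classical in
/-- The action of a simple reflection on `W × ZMod 2` by which inversions are counted. -/
noncomputable def signedConj (i : I) : Function.End (W × ZMod 2) := fun p ↦
  (cs.simple i * p.1 * cs.simple i, p.2 + if p.1 = cs.simple i then 1 else 0)

open scoped Classical in
theorem signedConj_mul_apply (i j : I) (p : W × ZMod 2) :
    (cs.signedConj i * cs.signedConj j) p =
      (cs.simple i * (cs.simple j * p.1 * cs.simple j) * cs.simple i,
        (p.2 + if p.1 = cs.simple j then 1 else 0) +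
          if cs.simple j * p.1 * cs.simple j = cs.simple i then 1 else 0) :=
  rfl

open scoped Classical in
theorem signedConj_mul_pow_apply (i j : I) (n : ℕ) (t : W) (ε : ZMod 2) :
    ((cs.signedConj i * cs.signedConj j) ^ n) (t, ε) =
      ((cs.simple i * cs.simple j) ^ n * t * ((cs.simple i * cs.simple j) ^ n)⁻¹,
        ε + ∑ k ∈ Finset.range (2 * n),
          if t = ((cs.simple i * cs.simple j) ^ k)⁻¹ * cs.simple j then 1 else 0) := by
  induction n with
  | zero => simp; rfl
  | succ n ih =>
    have hinv : (cs.simple i * cs.simple j)⁻¹ = cs.simple j * cs.simple i := by simp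
    set a := cs.simple i
    set b := cs.simple j
    have hb : b⁻¹ = b := cs.inv_simple j
    have hflip (k : ℕ) : b * (a * b) ^ k = ((a * b) ^ k)⁻¹ * b := by
      rw [← inv_pow, hinv]
      induction k with
      | zero => simp
      | succ k ihk =>
        rw [pow_succ, ← mul_assoc, ihk, pow_succ]
        simp only [mul_assoc]
    have hconj (x c : W) : x * t * x⁻¹ = c ↔ t = x⁻¹ * c * x := by
      constructor <;> rintro rfl <;> group
    have e1 : (a * b) ^ n * t * ((a * b) ^ n)⁻¹ = b ↔ t = ((a * b) ^ (2 * n))⁻¹ * b := by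
      rw [hconj, mul_assoc, hflip, two_mul, pow_add, mul_inv_rev, mul_assoc]
    have e2 : b * ((a * b) ^ n * t * ((a * b) ^ n)⁻¹) * b = a ↔
        t = ((a * b) ^ (2 * n + 1))⁻¹ * b := by
      have h1 : b * ((a * b) ^ n * t * ((a * b) ^ n)⁻¹) * b =
          b * (a * b) ^ n * t * (b * (a * b) ^ n)⁻¹ := by
        rw [mul_inv_rev, hb]; simp only [mul_assoc]
      have h2 : ((a * b) ^ (2 * n + 1))⁻¹ * b = ((a * b) ^ n)⁻¹ * b * a * (b * (a * b) ^ n) := by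
        rw [hflip, show 2 * n + 1 = n + 1 + n by ring, pow_add, pow_succ, mul_inv_rev, mul_inv_rev,
          hinv]
        simp only [mul_assoc]
      rw [h1, h2, hconj, mul_inv_rev, hb]
    rw [pow_succ', show 2 * (n + 1) = 2 * n + 1 + 1 by ring,
      Finset.sum_range_succ, Finset.sum_range_succ]
    change (cs.signedConj i * cs.signedConj j)
      (((cs.signedConj i * cs.signedConj j) ^ n) (t, ε)) = _
    rw [ih, signedConj_mul_apply]
    refine Prod.ext ?_ ?_
    · simp only [pow_succ', mul_inv_rev, mul_assoc, a, b, inv_simple]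
    · simp only [← add_assoc]
      congr 1
      · congr 1
        exact if_congr e1 rfl rfl
      · exact if_congr e2 rfl rfl

theorem isLiftable_signedConj : M.IsLiftable cs.signedConj := by
  classical
  intro i j
  funext ⟨t, ε⟩
  rw [signedConj_mul_pow_apply, simple_mul_simple_pow, two_mul, Finset.sum_range_add]
  simp only [pow_add, simple_mul_simple_pow, one_mul, CharTwo.add_self_eq_zero]
  simp
  rfl

/-- `cs.inversion w t` is `1` if `t` is a right inversion of `w`, and `0` otherwise. -/
noncomputable def inversion (w t : W) : ZMod 2 :=
  (cs.lift ⟨_, cs.isLiftable_signedConj⟩ w (t, 0)).2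

theorem lift_signedConj_apply (w t : W) (ε : ZMod 2) :
    cs.lift ⟨_, cs.isLiftable_signedConj⟩ w (t, ε) = (w * t * w⁻¹, ε + cs.inversion w t) := by
  induction w using cs.simple_induction_left generalizing t ε with
  | one =>
    rw [inversion, map_one]
    change (t, ε) = (_, ε + 0)
    simp
  | mul_simple_left w i ih =>
    have (ε : ZMod 2) : cs.lift ⟨_, cs.isLiftable_signedConj⟩ (cs.simple i * w) (t, ε) =
        cs.signedConj i (w * t * w⁻¹, ε + cs.inversion w t) := by
      rw [← ih, map_mul, lift_apply_simple]; rfl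
    rw [inversion, this, this]
    simp only [signedConj]
    refine Prod.ext ?_ ?_
    · simp [mul_assoc]
    · simp [add_assoc]

theorem inversion_mul (v w t : W) :
    cs.inversion (v * w) t = cs.inversion w t + cs.inversion v (w * t * w⁻¹) := by
  rw [inversion, map_mul]
  change (cs.lift ⟨_, cs.isLiftable_signedConj⟩ v
    (cs.lift ⟨_, cs.isLiftable_signedConj⟩ w (t, 0))).2 = _
  simp [lift_signedConj_apply]

@[simp]
theorem inversion_one (t : W) : cs.inversion 1 t = 0 := by
  rw [inversion, map_one]; rfl

open scoped Classical in
theorem inversion_simple (i : I) (t : W) :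
    cs.inversion (cs.simple i) t = if t = cs.simple i then 1 else 0 := by
  rw [inversion, lift_apply_simple]
  simp [signedConj]

theorem inversion_simple_self (i : I) : cs.inversion (cs.simple i) (cs.simple i) = 1 := by
  simp [inversion_simple]

theorem inversion_simple_of_ne {i : I} {t : W} (h : t ≠ cs.simple i) :
    cs.inversion (cs.simple i) t = 0 := by
  simp [inversion_simple, h]

theorem inversion_inv (w t : W) : cs.inversion w⁻¹ t = cs.inversion w (w⁻¹ * t * w) := by
  have h := cs.inversion_mul w w⁻¹ t
  rw [mul_inv_cancel, inversion_one, inv_inv, eq_comm, CharTwo.add_eq_zero] at h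
  exact h

theorem mem_rightInvSeq_of_inversion_ne_zero {ω : List I} {t : W}
    (h : cs.inversion (cs.wordProd ω) t ≠ 0) : t ∈ cs.rightInvSeq ω := by
  induction ω with
  | nil => simp at h
  | cons i ω ih =>
    rw [rightInvSeq, List.mem_cons]
    by_cases ht : cs.inversion (cs.wordProd ω) t = 0
    · left
      rw [wordProd_cons, inversion_mul, ht, zero_add] at h
      have := not_imp_comm.mp cs.inversion_simple_of_ne h
      rw [← this]
      group
    · exact .inr (ih ht)

theorem finite_setOf_inversion_ne_zero (w : W) : {t | cs.inversion w t ≠ 0}.Finite := by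
  obtain ⟨ω, rfl⟩ := cs.wordProd_surjective w
  exact (List.finite_toSet (cs.rightInvSeq ω)).subset
    fun t ht ↦ cs.mem_rightInvSeq_of_inversion_ne_zero ht

theorem length_mul_lt_of_inversion_ne_zero {w t : W} (h : cs.inversion w t ≠ 0) :
    cs.length (w * t) < cs.length w := by
  obtain ⟨ω, hω, rfl⟩ := cs.exists_isReduced w
  exact (cs.isRightInversion_of_mem_rightInvSeq hω
    (cs.mem_rightInvSeq_of_inversion_ne_zero h)).2

theorem inversion_eq_one_of_isRightDescent {w : W} {i : I} (h : cs.IsRightDescent w i) :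
    cs.inversion w (cs.simple i) = 1 := by
  have h0 : cs.inversion (w * cs.simple i) (cs.simple i) = 0 := by
    by_contra hne
    have := cs.length_mul_lt_of_inversion_ne_zero hne
    rw [simple_mul_simple_cancel_right] at this
    exact this.asymm h
  rw [inversion_mul, inversion_simple_self, simple_mul_simple_self, one_mul, inv_simple,
    CharTwo.add_eq_zero] at h0
  exact h0.symm

end Cocycle

/-! ### Standard parabolic subgroups -/

section Parabolic

variable {J : Set I} {u : W}

theorem simple_mem_parabolic {i : I} (hi : i ∈ J) : cs.simple i ∈ cs.parabolic J :=
  cs.simple_mem_parabolic_iff.mpr hi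

theorem parabolic_mono {J K : Set I} (h : J ⊆ K) : cs.parabolic J ≤ cs.parabolic K :=
  closure_mono (Set.image_mono h)

theorem mem_parabolic_of_inversion_ne_zero {t : W} (hu : u ∈ cs.parabolic J)
    (h : cs.inversion u t ≠ 0) : t ∈ cs.parabolic J := by
  induction hu using closure_induction generalizing t with
  | mem x hx =>
    obtain ⟨j, hj, rfl⟩ := hx
    rw [not_imp_comm.mp cs.inversion_simple_of_ne h]
    exact cs.simple_mem_parabolic hj
  | one => simp at h
  | mul x y _ hy ihx ihy =>
    by_cases hyt : cs.inversion y t = 0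
    · rw [inversion_mul, hyt, zero_add] at h
      have := mul_mem (mul_mem (inv_mem hy) (ihx h)) hy
      simpa [mul_assoc] using this
    · exact ihy hyt
  | inv x hx ih =>
    rw [inversion_inv] at h
    have := mul_mem (mul_mem hx (ih h)) (inv_mem hx)
    simpa [mul_assoc] using this

theorem mem_of_isRightDescent {i : I} (hu : u ∈ cs.parabolic J) (h : cs.IsRightDescent u i) :
    i ∈ J :=
  cs.simple_mem_parabolic_iff.mp <| cs.mem_parabolic_of_inversion_ne_zero hu
    (by rw [cs.inversion_eq_one_of_isRightDescent h]; exact one_ne_zero)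

theorem mem_parabolic_sInter {𝒥 : Set (Set I)} (h : ∀ J ∈ 𝒥, u ∈ cs.parabolic J) :
    u ∈ cs.parabolic (⋂₀ 𝒥) := by
  induction hn : cs.length u using Nat.strong_induction_on generalizing u with
  | _ n ih =>
    obtain rfl | hu := eq_or_ne u 1
    · exact one_mem _
    obtain ⟨i, hi⟩ := cs.exists_rightDescent_of_ne_one hu
    have hiJ (J) (hJ : J ∈ 𝒥) : i ∈ J := cs.mem_of_isRightDescent (h J hJ) hi
    have := mul_mem
      (ih _ (hn ▸ hi) (fun J hJ ↦ mul_mem (h J hJ) (cs.simple_mem_parabolic (hiJ J hJ))) rfl)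
      (cs.simple_mem_parabolic hiJ)
    rwa [simple_mul_simple_cancel_right] at this

theorem parabolic_inf_eq_bot {J K : Set I} (h : Disjoint J K) :
    cs.parabolic J ⊓ cs.parabolic K = ⊥ := by
  refine (eq_bot_iff_forall _).mpr fun u hu ↦ by_contra fun h1 ↦ ?_
  obtain ⟨i, hi⟩ := cs.exists_rightDescent_of_ne_one h1
  exact h.notMem_of_mem_left (cs.mem_of_isRightDescent hu.1 hi) (cs.mem_of_isRightDescent hu.2 hi)

theorem commute_of_conj_mem_parabolic {i j : I} (hi : i ∉ J)
    (h : cs.simple i * cs.simple j * cs.simple i ∈ cs.parabolic J) (hj : j ∈ J) :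
    Commute (cs.simple i) (cs.simple j) := by
  have hsi : cs.simple i ∉ cs.parabolic J := fun hs ↦ hi (cs.simple_mem_parabolic_iff.mp hs)
  have h0 : cs.inversion (cs.simple i * cs.simple j * cs.simple i) (cs.simple i) = 0 :=
    by_contra fun hne ↦ hsi (cs.mem_parabolic_of_inversion_ne_zero h hne)
  have hne : cs.simple i ≠ cs.simple j := fun he ↦ hsi (he ▸ cs.simple_mem_parabolic hj)
  rw [inversion_mul, inversion_mul, inversion_simple_self, simple_mul_simple_self, one_mul,
    inv_simple, inv_simple, cs.inversion_simple_of_ne hne, zero_add] at h0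
  by_contra hc
  rw [cs.inversion_simple_of_ne, add_zero] at h0
  · exact one_ne_zero h0
  · intro he
    apply hc
    have := congrArg (cs.simple j * ·) he
    rw [commute_iff_eq]
    simpa [mul_assoc] using this

/-- Elements of a standard parabolic subgroup which remain in it under conjugation by an outer
simple reflection commute with that reflection letter by letter. -/
theorem mem_parabolic_commute_of_conj_mem {i : I} (hi : i ∉ J) (hu : u ∈ cs.parabolic J)
    (hc : cs.simple i * u * cs.simple i ∈ cs.parabolic J) :
    u ∈ cs.parabolic {j ∈ J | Commute (cs.simple i) (cs.simple j)} := by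
  induction hn : cs.length u using Nat.strong_induction_on generalizing u with
  | _ n ih =>
    obtain rfl | h1 := eq_or_ne u 1
    · exact one_mem _
    have hsi : cs.simple i ∉ cs.parabolic J := fun hs ↦ hi (cs.simple_mem_parabolic_iff.mp hs)
    obtain ⟨j, hj⟩ := cs.exists_rightDescent_of_ne_one h1
    have hjJ := cs.mem_of_isRightDescent hu hj
    have hsj := cs.simple_mem_parabolic hjJ
    have hne : cs.simple j ≠ cs.simple i := fun he ↦ hsi (he ▸ hsj)
    have hij : Commute (cs.simple i) (cs.simple j) := by
      refine cs.commute_of_conj_mem_parabolic hi ?_ hjJ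
      refine cs.mem_parabolic_of_inversion_ne_zero hc ?_
      have e1 : cs.inversion (cs.simple i * u) (cs.simple j) = 1 := by
        rw [inversion_mul, cs.inversion_eq_one_of_isRightDescent hj, cs.inversion_simple_of_ne,
          add_zero]
        intro he
        exact hsi (he ▸ mul_mem (mul_mem hu hsj) (inv_mem hu))
      have e2 := cs.inversion_mul (cs.simple i * u * cs.simple i) (cs.simple i) (cs.simple j)
      rw [simple_mul_simple_cancel_right, e1, cs.inversion_simple_of_ne hne, zero_add,
        inv_simple] at e2
      rw [← e2]
      exact one_ne_zero
    have := mul_mem (ih _ (hn ▸ hj) (mul_mem hu hsj)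
      (by simpa only [mul_assoc, hij.eq] using mul_mem hc hsj) rfl)
      (cs.simple_mem_parabolic (J := {j ∈ J | Commute (cs.simple i) (cs.simple j)}) ⟨hjJ, hij⟩)
    rwa [simple_mul_simple_cancel_right] at this

/-- The visual subgroup generated by `B` has no nontrivial finite visual direct factor. -/
def HasNoFiniteFactor (B : Set I) : Prop :=
  ∀ C ⊆ B, Finite (cs.parabolic C) →
    (∀ c ∈ C, ∀ b ∈ B \ C, Commute (cs.simple c) (cs.simple b)) → C = ∅

variable {B : Set I}

theorem HasNoFiniteFactor.subset_of_finite_quotient {cs : CoxeterSystem M W} {K : Set I}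
    (hB : cs.HasNoFiniteFactor B)
    (hK : Finite (cs.parabolic B ⧸ (cs.parabolic K).subgroupOf (cs.parabolic B))) : B ⊆ K := by
  have := finiteIndex_of_finite_quotient (H := (cs.parabolic K).subgroupOf (cs.parabolic B))
  set N := ((cs.parabolic K).subgroupOf (cs.parabolic B)).normalCore
  set J : Set I := ⋂₀ {J | ∀ n ∈ N, (n : W) ∈ cs.parabolic J}
  have hNJ (n) (hn : n ∈ N) : (n : W) ∈ cs.parabolic J :=
    cs.mem_parabolic_sInter fun _ hJ' ↦ hJ' n hn
  have hJK : J ⊆ K := Set.sInter_subset_of_mem fun n hn ↦ mem_subgroupOf.mp (normalCore_le _ hn)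
  have hcomm (i) (hi : i ∈ B \ J) (j) (hj : j ∈ J) : Commute (cs.simple i) (cs.simple j) := by
    refine (Set.sInter_subset_of_mem (t := {j ∈ J | Commute (cs.simple i) (cs.simple j)})
      (fun n hn ↦ ?_) hj).2
    refine cs.mem_parabolic_commute_of_conj_mem hi.2 (hNJ n hn) ?_
    simpa using hNJ _ ((normalCore_normal _).conj_mem n hn ⟨_, cs.simple_mem_parabolic hi.1⟩)
  have hfin : Finite (cs.parabolic (B \ J)) := by
    have hle := cs.parabolic_mono (J := B \ J) Set.sdiff_subset
    refine Finite.of_injective (fun x ↦ (Subgroup.inclusion hle x : cs.parabolic B ⧸ N))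
      fun x y hxy ↦ ?_
    have h1 := hNJ _ (QuotientGroup.eq.mp hxy)
    have h2 : (x⁻¹ * y : W) ∈ cs.parabolic J ⊓ cs.parabolic (B \ J) := ⟨h1, (x⁻¹ * y).2⟩
    rw [cs.parabolic_inf_eq_bot Set.disjoint_sdiff_right, mem_bot] at h2
    exact Subtype.ext (inv_mul_eq_one.mp h2)
  have := hB _ Set.sdiff_subset hfin fun i hi j hj ↦ hcomm i hi j (by simpa [hj.1] using hj.2)
  exact (Set.sdiff_eq_empty.mp this).trans hJK

theorem HasNoFiniteFactor.commute_of_finite_conj {cs : CoxeterSystem M W}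
    (hB : cs.HasNoFiniteFactor B) {i : I} (hi : i ∉ B)
    (hfin : {t | ∃ u ∈ cs.parabolic B, u * cs.simple i * u⁻¹ = t}.Finite) {b : I} (hb : b ∈ B) :
    Commute (cs.simple i) (cs.simple b) := by
  refine (hB.subset_of_finite_quotient (K := {j ∈ B | Commute (cs.simple i) (cs.simple j)})
    ?_ hb).2
  have := hfin.to_subtype
  refine Finite.of_injective (fun q ↦ (⟨_, q.out, q.out.2, rfl⟩ :
    {t | ∃ u ∈ cs.parabolic B, u * cs.simple i * u⁻¹ = t})) fun p q hpq ↦ ?_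
  rw [← p.out_eq', ← q.out_eq', QuotientGroup.eq, mem_subgroupOf]
  have h : (p.out : W) * cs.simple i * (p.out : W)⁻¹ = q.out * cs.simple i * (q.out : W)⁻¹ :=
    congrArg Subtype.val hpq
  refine cs.mem_parabolic_commute_of_conj_mem hi (p.out⁻¹ * q.out).2 ?_
  have h' : cs.simple i * ((p.out⁻¹ * q.out : cs.parabolic B) : W) * cs.simple i =
      (p.out⁻¹ * q.out : cs.parabolic B) := by
    rw [mul_inv_eq_iff_eq_mul] at h
    rw [← mul_left_inj (cs.simple i), simple_mul_simple_cancel_right]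
    simp only [coe_mul, coe_inv]
    rw [← mul_right_inj (p.out : W)]
    simp only [← mul_assoc, h]
    simp [mul_assoc]
  rw [h']
  exact (p.out⁻¹ * q.out).2

/-- Deodhar's rigidity: an element of minimal length in its right `B`-coset which conjugates each
generator in `B` to a simple reflection centralizes `B`, if `B` has no finite visual factor. -/
theorem HasNoFiniteFactor.commute_of_conj_simple {cs : CoxeterSystem M W}
    (hB : cs.HasNoFiniteFactor B) {d : W} (hd : ∀ b ∈ B, ¬ cs.IsRightDescent d b)
    (hconj : ∀ b ∈ B, ∃ j, d * cs.simple b * d⁻¹ = cs.simple j) {b : I} (hb : b ∈ B) :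
    Commute d (cs.simple b) := by
  induction hn : cs.length d using Nat.strong_induction_on generalizing d b with
  | _ n ih =>
    obtain rfl | h1 := eq_or_ne d 1
    · exact Commute.one_left _
    obtain ⟨i, hi⟩ := cs.exists_rightDescent_of_ne_one h1
    have hiB : i ∉ B := fun h ↦ hd i h hi
    have hsi : cs.simple i ∉ cs.parabolic B := fun h ↦ hiB (cs.simple_mem_parabolic_iff.mp h)
    set B' : Set I := {j | ∃ b ∈ B, d * cs.simple b * d⁻¹ = cs.simple j}
    have hBB' : cs.parabolic B ≤ (cs.parabolic B').comap (MulAut.conj d).toMonoidHom := by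
      rw [closure_le]
      rintro _ ⟨b, hb, rfl⟩
      obtain ⟨j, hj⟩ := hconj b hb
      simpa [hj] using cs.simple_mem_parabolic (show j ∈ B' from ⟨b, hb, hj⟩)
    have hB'B : cs.parabolic B' ≤ (cs.parabolic B).comap (MulAut.conj d⁻¹).toMonoidHom := by
      rw [closure_le]
      rintro _ ⟨j, ⟨b, hb, hj⟩, rfl⟩
      simpa [← hj, mul_assoc] using cs.simple_mem_parabolic hb
    have hinv (u : W) (hu : u ∈ cs.parabolic B) :
        cs.inversion d (u * cs.simple i * u⁻¹) = 1 := by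
      have hu' : d * u * d⁻¹ ∈ cs.parabolic B' := hBB' hu
      have e0 : cs.inversion u (cs.simple i) = 0 :=
        by_contra fun hne ↦ hsi (cs.mem_parabolic_of_inversion_ne_zero hu hne)
      have e1 : cs.inversion (d * u * d⁻¹) (d * cs.simple i * d⁻¹) = 0 := by
        refine by_contra fun hne ↦ hsi ?_
        simpa [mul_assoc] using hB'B (cs.mem_parabolic_of_inversion_ne_zero hu' hne)
      have e2 := cs.inversion_mul (d * u * d⁻¹) d (cs.simple i)
      rwa [inv_mul_cancel_right, inversion_mul, e0, e1, zero_add, add_zero,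
        cs.inversion_eq_one_of_isRightDescent hi] at e2
    have hcomm (b) (hb : b ∈ B) : Commute (cs.simple i) (cs.simple b) := by
      refine hB.commute_of_finite_conj hiB
        ((cs.finite_setOf_inversion_ne_zero d).subset ?_) hb
      rintro _ ⟨u, hu, rfl⟩
      simp [hinv u hu]
    have key : Commute (d * cs.simple i) (cs.simple b) := by
      refine ih _ (hn ▸ hi) (fun b hb hdesc ↦ ?_) (fun b hb ↦ ?_) hb rfl
      · have h1 := cs.inversion_eq_one_of_isRightDescent hdesc
        rw [inversion_mul, cs.inversion_simple_of_ne, (hcomm b hb).eq, mul_inv_cancel_right,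
          zero_add] at h1
        · exact hd b hb (cs.length_mul_lt_of_inversion_ne_zero (by simp [h1]))
        · exact fun he ↦ hsi (he ▸ cs.simple_mem_parabolic hb)
      · obtain ⟨j, hj⟩ := hconj b hb
        refine ⟨j, ?_⟩
        rw [← hj, mul_inv_rev, inv_simple, mul_assoc d, (hcomm b hb).eq]
        simp [mul_assoc]
    simpa using key.mul_left (hcomm b hb)

/-- Kilmoyer: an element of minimal length in its `(H, B)`-double coset which conjugates `⟨B⟩` into
`⟨H⟩` conjugates generators in `B` to simple reflections. -/
theorem exists_conj_simple_eq_simple {H : Set I} {d : W}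
    (hmin : ∀ h ∈ cs.parabolic H, ∀ a ∈ cs.parabolic B, cs.length d ≤ cs.length (h * d * a))
    (hconj : ∀ x ∈ cs.parabolic B, d * x * d⁻¹ ∈ cs.parabolic H) {b : I} (hb : b ∈ B) :
    ∃ j, d * cs.simple b * d⁻¹ = cs.simple j := by
  have hsb := cs.simple_mem_parabolic hb
  have hH := hconj _ hsb
  set h := d * cs.simple b * d⁻¹ with hdef
  have hd : h * d = d * cs.simple b := by simp [hdef]
  have hne : h ≠ 1 := by
    rw [hdef, ne_eq, conj_eq_one_iff]
    intro h1
    simpa [h1] using cs.length_simple b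
  obtain ⟨j, hj⟩ := cs.exists_rightDescent_of_ne_one hne
  have hsj := cs.simple_mem_parabolic (cs.mem_of_isRightDescent hH hj)
  refine ⟨j, ?_⟩
  set t := d⁻¹ * cs.simple j * d with ht
  have e0 : cs.inversion d t = 0 := by
    by_contra hne
    have h1 := cs.length_mul_lt_of_inversion_ne_zero hne
    have h2 := hmin _ hsj 1 (one_mem _)
    rw [ht, mul_assoc d⁻¹, mul_inv_cancel_left] at h1
    rw [mul_one] at h2
    omega
  have e1 : cs.inversion (h * d) t = 1 := by
    rw [inversion_mul, e0, zero_add, ht, ← cs.inversion_eq_one_of_isRightDescent hj]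
    congr 1
    group
  by_cases htb : t = cs.simple b
  · rw [hdef, ← htb, ht]
    group
  · rw [hd, inversion_mul, cs.inversion_simple_of_ne htb, zero_add] at e1
    have h1 := cs.length_mul_lt_of_inversion_ne_zero (by rw [e1]; exact one_ne_zero)
    have h2 := hmin _ (mul_mem hH hsj) _ (inv_mem hsb)
    have h3 : d * (cs.simple b * t * (cs.simple b)⁻¹) =
        h * cs.simple j * d * (cs.simple b)⁻¹ := by
      rw [ht, hdef]
      group
    rw [h3] at h1
    omega

theorem HasNoFiniteFactor.subset_of_conj_le {cs : CoxeterSystem M W} {H : Set I}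
    (hB : cs.HasNoFiniteFactor B) {w : W}
    (hconj : ∀ x ∈ cs.parabolic B, w * x * w⁻¹ ∈ cs.parabolic H) : B ⊆ H := by
  obtain ⟨_, ⟨h, hh, a, ha, rfl⟩, hmin⟩ := (measure cs.length).wf.has_min
    {d | ∃ h ∈ cs.parabolic H, ∃ a ∈ cs.parabolic B, h * w * a = d}
    ⟨w, 1, one_mem _, 1, one_mem _, by simp⟩
  set d := h * w * a with hd
  replace hmin (h') (hh' : h' ∈ cs.parabolic H) (a') (ha' : a' ∈ cs.parabolic B) :
      cs.length d ≤ cs.length (h' * d * a') :=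
    not_lt.mp (hmin _ ⟨h' * h, mul_mem hh' hh, a * a', mul_mem ha ha', by simp [hd, mul_assoc]⟩)
  replace hconj (x) (hx : x ∈ cs.parabolic B) : d * x * d⁻¹ ∈ cs.parabolic H := by
    have := mul_mem (mul_mem hh (hconj _ (mul_mem (mul_mem ha hx) (inv_mem ha)))) (inv_mem hh)
    simpa [hd, mul_assoc] using this
  intro b hb
  have hcomm : Commute d (cs.simple b) := by
    refine hB.commute_of_conj_simple (fun b hb hdesc ↦ ?_)
      (fun b hb ↦ cs.exists_conj_simple_eq_simple hmin hconj hb) hb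
    have := hmin 1 (one_mem _) _ (cs.simple_mem_parabolic hb)
    rw [one_mul] at this
    exact this.not_gt hdesc
  have := hconj _ (cs.simple_mem_parabolic hb)
  rwa [hcomm.eq, mul_inv_cancel_right, simple_mem_parabolic_iff] at this

end Parabolic

end CoxeterSystem

/-- Suppose `⟨A⟩ = ⟨B⟩ × ⟨C⟩` where `B ∪ C = A`, `⟨C⟩` is finite, and `C` is
the unique largest subset of `A` such that `⟨C⟩` is finite and splits off as a
visual direct factor of `⟨A⟩`. If `w⟨A⟩w⁻¹ ⊆ ⟨H⟩` for some `w ∈ W`, `H ⊆ S`,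
then `B ⊆ H`. -/
theorem essential_part_of_conjugate_parabolic {S : Type*} {W : Type*} [Group W]
    (M : CoxeterMatrix S) (cs : CoxeterSystem M W) (A B C H : Set S) (w : W)
    (hBC : B ∪ C = A) (hd : Disjoint B C)
    (hfin : Finite (closure (cs.simple '' C)))
    (hcomm : ∀ b ∈ B, ∀ c ∈ C, Commute (cs.simple b) (cs.simple c))
    (hinfl : closure (cs.simple '' B) ⊓ closure (cs.simple '' C) = ⊥)
    (hmax : ∀ C' ⊆ A, Finite (closure (cs.simple '' C')) →
      (∀ c ∈ C', ∀ a ∈ A \ C', Commute (cs.simple c) (cs.simple a)) →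
      closure (cs.simple '' (A \ C')) ⊓ closure (cs.simple '' C') = ⊥ →
      C' ⊆ C)
    (hconj : ∀ x ∈ closure (cs.simple '' A),
      w * x * w⁻¹ ∈ closure (cs.simple '' H)) :
    B ⊆ H := by
  have hB : cs.HasNoFiniteFactor B := by
    intro C' hC' hfin' hcomm'
    have hle : C' ⊆ C := by
      refine hmax C' (hC'.trans (hBC ▸ Set.subset_union_left)) hfin' ?_
        (cs.parabolic_inf_eq_bot Set.disjoint_sdiff_left)
      rintro c hc a ⟨ha, haC'⟩
      rw [← hBC] at ha
      exact ha.elim (fun h ↦ hcomm' c hc a ⟨h, haC'⟩) fun h ↦ hcomm c (hC' hc) a h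
    exact Set.eq_empty_of_forall_notMem fun c hc ↦ hd.notMem_of_mem_left (hC' hc) (hle hc)
  exact hB.subset_of_conj_le fun x hx ↦
    hconj x (cs.parabolic_mono (hBC ▸ Set.subset_union_left) hx)
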